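/- Let n ≥ 3 and let G be a finite-index subgroup of the braid group B_{n+1}. Then the center Z(G) of G equals G ∩ Z(B_{n+1}); in particular, Z(G) is infinite cyclic and every central element of G is a power of the full twist z. -/

import Mathlib

/-- The braid relations on `n` generators `σ_1, …, σ_n` (indexed by `Fin n`):
`σ_i σ_j σ_i = σ_j σ_i σ_j` when `j = i + 1`, and `σ_i σ_j = σ_j σ_i` when `j ≥ i + 2`.
The resulting presented group is the braid group `B_{n+1}` on `n+1` strands. -/
def braidRels (n : ℕ) : Set (FreeGroup (Fin n)) :=
  {r | (∃ i j : Fin n, (i : ℕ) + 1 = (j : ℕ) ∧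
          r = .of i * .of j * .of i * (.of j * .of i * .of j)⁻¹) ∨
       (∃ i j : Fin n, (i : ℕ) + 2 ≤ (j : ℕ) ∧
          r = .of i * .of j * (.of j * .of i)⁻¹)}

/-- The braid group `B_{n+1}` on `n+1` strands, presented with `n` generators. -/
abbrev BraidGroup (n : ℕ) : Type := PresentedGroup (braidRels n)

/-- The standard generator `σ_{i+1}` of the braid group. -/
def braidGen {n : ℕ} (i : Fin n) : BraidGroup n := PresentedGroup.of i

/-- The full twist `z = (σ_1 σ_2 ⋯ σ_n)^{n+1}`, which generates the center of `B_{n+1}`. -/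
def fullTwist (n : ℕ) : BraidGroup n :=
  ((List.ofFn fun i : Fin n => braidGen i).prod) ^ (n + 1)

/-- The defining relations of the small type Artin monoid of a graph `Γ`: adjacent generators
satisfy the braid relation, the other pairs of generators commute. -/
inductive ArtinRel {S : Type*} (Γ : SimpleGraph S) : FreeMonoid S → FreeMonoid S → Prop
  | braid {a b : S} : Γ.Adj a b →
      ArtinRel Γ (.of a * .of b * .of a) (.of b * .of a * .of b)
  | comm {a b : S} : ¬ Γ.Adj a b → ArtinRel Γ (.of a * .of b) (.of b * .of a)

/-- The small type Artin monoid of a graph. -/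
abbrev ArtinMonoid {S : Type*} (Γ : SimpleGraph S) : Type _ := PresentedMonoid (ArtinRel Γ)

namespace ArtinMonoid

variable {S : Type*} {Γ : SimpleGraph S}

/-- The standard generators of an Artin monoid. -/
def gen (Γ : SimpleGraph S) (a : S) : ArtinMonoid Γ := PresentedMonoid.of (ArtinRel Γ) a

theorem gen_comm {a b : S} (h : ¬ Γ.Adj a b) : gen Γ a * gen Γ b = gen Γ b * gen Γ a :=
  PresentedMonoid.mk_eq_mk_of_rel (.comm h)

theorem gen_braid {a b : S} (h : Γ.Adj a b) :
    gen Γ a * gen Γ b * gen Γ a = gen Γ b * gen Γ a * gen Γ b :=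
  PresentedMonoid.mk_eq_mk_of_rel (.braid h)

theorem gen_comm_assoc {a b : S} (h : ¬ Γ.Adj a b) (x : ArtinMonoid Γ) :
    gen Γ a * (gen Γ b * x) = gen Γ b * (gen Γ a * x) := by
  rw [← mul_assoc, gen_comm h, mul_assoc]

theorem gen_braid_assoc {a b : S} (h : Γ.Adj a b) (x : ArtinMonoid Γ) :
    gen Γ a * (gen Γ b * (gen Γ a * x)) = gen Γ b * (gen Γ a * (gen Γ b * x)) := by
  simp only [← mul_assoc, gen_braid h]

/-- The word length, as a homomorphism. -/
def lengthHom (Γ : SimpleGraph S) : ArtinMonoid Γ →* Multiplicative ℕ :=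
  PresentedMonoid.lift (fun _ => Multiplicative.ofAdd 1) (by
    rintro _ _ (h | h) <;> simp)

/-- The word length of an element of an Artin monoid. -/
def length (x : ArtinMonoid Γ) : ℕ := (lengthHom Γ x).toAdd

@[simp] theorem length_one : length (1 : ArtinMonoid Γ) = 0 := rfl

@[simp] theorem length_mul (x y : ArtinMonoid Γ) : length (x * y) = length x + length y := by
  simp [length]

@[simp] theorem length_gen (a : S) : length (gen Γ a) = 1 := rfl

theorem length_mk (w : FreeMonoid S) : length (PresentedMonoid.mk (ArtinRel Γ) w) = w.length := by
  induction w with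
  | one => simp
  | of x => rfl
  | mul x y hx hy => simp [hx, hy]

theorem eq_one_or_exists_gen_mul (x : ArtinMonoid Γ) : x = 1 ∨ ∃ a y, x = gen Γ a * y := by
  obtain ⟨w, rfl⟩ := PresentedMonoid.surjective_mk x
  induction w using FreeMonoid.casesOn with
  | one => exact .inl (map_one _)
  | of_mul a w => exact .inr ⟨a, PresentedMonoid.mk _ w, map_mul _ _ _⟩

/-- The relation between `u` and `v` expressing that `a u = b v` is a common right multiple of
the least common right multiple of the generators `a` and `b`. -/
inductive LcmRel (Γ : SimpleGraph S) : S → S → ArtinMonoid Γ → ArtinMonoid Γ → Prop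
  | eq (a u) : LcmRel Γ a a u u
  | comm {a b} (w) : a ≠ b → ¬ Γ.Adj a b → LcmRel Γ a b (gen Γ b * w) (gen Γ a * w)
  | braid {a b} (w) : Γ.Adj a b →
      LcmRel Γ a b (gen Γ b * (gen Γ a * w)) (gen Γ a * (gen Γ b * w))

namespace LcmRel

variable {a b c : S} {u v w : ArtinMonoid Γ}

theorem symm (h : LcmRel Γ a b u v) : LcmRel Γ b a v u := by
  cases h with
  | eq => exact .eq _ _
  | comm w h1 h2 => exact .comm w h1.symm (fun h => h2 h.symm)
  | braid w h => exact .braid w h.symm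

theorem mul_right (h : LcmRel Γ a b u v) (x : ArtinMonoid Γ) :
    LcmRel Γ a b (u * x) (v * x) := by
  cases h with
  | eq => exact .eq _ _
  | comm w h1 h2 => simpa only [mul_assoc] using .comm (w * x) h1 h2
  | braid w h => simpa only [mul_assoc] using .braid (w * x) h

theorem eq_of_self (h : LcmRel Γ a a u v) : u = v := by
  cases h with
  | eq => rfl
  | comm w h1 h2 => rfl
  | braid w h => rfl

theorem exists_of_not_adj (h : LcmRel Γ a b u v) (hab : a ≠ b) (hn : ¬ Γ.Adj a b) :
    ∃ w, u = gen Γ b * w ∧ v = gen Γ a * w := by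
  cases h with
  | eq => exact absurd rfl hab
  | comm w h1 h2 => exact ⟨w, rfl, rfl⟩
  | braid w h => exact absurd h hn

theorem exists_of_adj (h : LcmRel Γ a b u v) (hab : Γ.Adj a b) :
    ∃ w, u = gen Γ b * (gen Γ a * w) ∧ v = gen Γ a * (gen Γ b * w) := by
  cases h with
  | eq => exact absurd hab (Γ.irrefl)
  | comm w h1 h2 => exact absurd hab h2
  | braid w h => exact ⟨w, rfl, rfl⟩

/-- Transitivity of `LcmRel` when `a` is adjacent to both `b` and `c`, and `b` and `c` are distinct
and not adjacent. -/
theorem trans_of_adj_of_adj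
    (ih : ∀ (a b : S) (p q : ArtinMonoid Γ), length p < length w →
      gen Γ a * p = gen Γ b * q → LcmRel Γ a b p q)
    (hab : Γ.Adj a b) (hac : Γ.Adj a c) (hcb : ¬ Γ.Adj c b) (hne : c ≠ b)
    (h1 : LcmRel Γ a c u w) (h2 : LcmRel Γ c b w v) : LcmRel Γ a b u v := by
  obtain ⟨p, rfl, rfl⟩ := h1.exists_of_adj hac
  obtain ⟨q, hq, rfl⟩ := h2.exists_of_not_adj hne hcb
  obtain ⟨r, hr, rfl⟩ := (ih _ _ _ _ (by simp) hq).exists_of_adj hab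
  obtain ⟨s, rfl, hs⟩ := (ih _ _ _ _ (by simp; omega) hr).exists_of_not_adj hne hcb
  have hl := congrArg length hr
  simp only [length_mul, length_gen] at hl
  obtain ⟨t, rfl, rfl⟩ := (ih _ _ _ _ (by simp; omega) hs).exists_of_adj hac
  have e1 : gen Γ c * (gen Γ a * (gen Γ b * (gen Γ a * (gen Γ c * t)))) =
      gen Γ b * (gen Γ a * (gen Γ c * (gen Γ a * (gen Γ b * t)))) := by
    rw [gen_braid_assoc hab, gen_comm_assoc hcb, gen_comm_assoc (a := b) (b := c)
      (fun h => hcb h.symm) t, gen_braid_assoc hac.symm]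
  have e2 : gen Γ c * (gen Γ a * (gen Γ b * (gen Γ c * (gen Γ a * t)))) =
      gen Γ a * (gen Γ b * (gen Γ c * (gen Γ a * (gen Γ b * t)))) := by
    rw [gen_comm_assoc (a := b) (b := c) (fun h => hcb h.symm), gen_braid_assoc hac.symm,
      gen_braid_assoc hab, gen_comm_assoc hcb]
  rw [e1, e2]
  exact .braid _ hab

/-- Transitivity of `LcmRel` when `a` and `c` are adjacent, and `b` is distinct from and not
adjacent to either of them. -/
theorem trans_of_not_adj_of_adj
    (ih : ∀ (a b : S) (p q : ArtinMonoid Γ), length p < length w →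
      gen Γ a * p = gen Γ b * q → LcmRel Γ a b p q)
    (hab : ¬ Γ.Adj a b) (hne : a ≠ b) (hac : Γ.Adj a c) (hcb : ¬ Γ.Adj c b) (hne' : c ≠ b)
    (h1 : LcmRel Γ a c u w) (h2 : LcmRel Γ c b w v) : LcmRel Γ a b u v := by
  obtain ⟨p, rfl, rfl⟩ := h1.exists_of_adj hac
  obtain ⟨q, hq, rfl⟩ := h2.exists_of_not_adj hne' hcb
  obtain ⟨r, hr, rfl⟩ := (ih _ _ _ _ (by simp) hq).exists_of_not_adj hne hab
  obtain ⟨s, rfl, rfl⟩ := (ih _ _ _ _ (by simp; omega) hr).exists_of_not_adj hne' hcb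
  rw [gen_comm_assoc hab, gen_comm_assoc hcb, gen_braid_assoc hac.symm]
  exact .comm _ hne hab

/-- Transitivity of `LcmRel` over a triangle-free graph, given Garside's lemma for elements of
smaller length. -/
theorem trans (hΓ : ∀ a b c, Γ.Adj a c → Γ.Adj c b → ¬ Γ.Adj a b)
    (ih : ∀ (a b : S) (p q : ArtinMonoid Γ), length p < length w →
      gen Γ a * p = gen Γ b * q → LcmRel Γ a b p q)
    (h1 : LcmRel Γ a c u w) (h2 : LcmRel Γ c b w v) : LcmRel Γ a b u v := by
  have huw : length u = length w := by cases h1 <;> simp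
  have hvw : length v = length w := by cases h2 <;> simp
  have hcancel : ∀ (a : S) (p q : ArtinMonoid Γ), length p < length w →
      gen Γ a * p = gen Γ a * q → p = q := fun a p q hl h => (ih a a p q hl h).eq_of_self
  by_cases hac : a = c
  · subst hac; rwa [h1.eq_of_self]
  by_cases hcb : c = b
  · subst hcb; rwa [← h2.eq_of_self]
  by_cases hac' : Γ.Adj a c <;> by_cases hcb' : Γ.Adj c b
  · obtain ⟨p, rfl, hp⟩ := h1.exists_of_adj hac'
    obtain ⟨q, hq, rfl⟩ := h2.exists_of_adj hcb'
    subst hp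
    by_cases hab : a = b
    · subst hab
      have := hcancel _ _ _ (by simp; omega) (hcancel _ _ _ (by simp) hq)
      rw [this]
      exact .eq _ _
    have hab' := hΓ _ _ _ hac' hcb'
    obtain ⟨r, hr, hr'⟩ := (ih _ _ _ _ (by simp) hq).exists_of_not_adj hab hab'
    have hl := congrArg length hr
    have hl' := congrArg length hr'
    simp only [length_mul, length_gen] at hl hl' hvw
    obtain ⟨s, rfl, rfl⟩ := (ih _ _ _ _ (by simp; omega) hr).exists_of_adj hcb'
    obtain ⟨t, rfl, ht⟩ := (ih _ _ _ _ (by simp at hl hl' hvw ⊢; omega) hr').exists_of_adj hac'.symm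
    have ht' := hcancel _ _ _ (by simp at hl hl' ⊢; omega) ht
    obtain ⟨x, rfl, rfl⟩ := (ih _ _ _ _ (by simp at hl hl' ⊢; omega) ht').exists_of_not_adj
      (Ne.symm hab) (fun h => hab' h.symm)
    have e1 : gen Γ c * (gen Γ a * (gen Γ b * (gen Γ c * (gen Γ a * x)))) =
        gen Γ b * (gen Γ c * (gen Γ b * (gen Γ a * (gen Γ c * x)))) := by
      rw [gen_comm_assoc hab', gen_braid_assoc hac', gen_braid_assoc hcb']
    have e2 : gen Γ c * (gen Γ b * (gen Γ a * (gen Γ c * (gen Γ b * x)))) =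
        gen Γ a * (gen Γ c * (gen Γ b * (gen Γ a * (gen Γ c * x)))) := by
      have hba : ¬ Γ.Adj b a := fun h => hab' h.symm
      rw [gen_comm_assoc hba, gen_braid_assoc hcb'.symm, gen_braid_assoc hac'.symm,
        gen_comm_assoc hab']
    rw [e1, e2]
    exact .comm _ hab hab'
  · have hab : a ≠ b := by rintro rfl; exact hcb' hac'.symm
    by_cases hab' : Γ.Adj a b
    · exact trans_of_adj_of_adj ih hab' hac' hcb' hcb h1 h2
    · exact trans_of_not_adj_of_adj ih hab' hab hac' hcb' hcb h1 h2
  · have hab : b ≠ a := by rintro rfl; exact hac' hcb'.symm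
    have hca : ¬ Γ.Adj c a := fun h => hac' h.symm
    by_cases hab' : Γ.Adj b a
    · exact (trans_of_adj_of_adj ih hab' hcb'.symm hca (Ne.symm hac) h2.symm h1.symm).symm
    · exact (trans_of_not_adj_of_adj ih hab' hab hcb'.symm hca (Ne.symm hac) h2.symm h1.symm).symm
  · obtain ⟨p, rfl, rfl⟩ := h1.exists_of_not_adj hac hac'
    obtain ⟨q, hq, rfl⟩ := h2.exists_of_not_adj hcb hcb'
    cases ih _ _ _ _ (by simp) hq with
    | eq => exact .eq _ _
    | comm r hab hab' =>
      rw [gen_comm_assoc hcb', gen_comm_assoc (fun h => hac' h.symm)]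
      exact .comm _ hab hab'
    | braid r hab =>
      rw [gen_comm_assoc hcb', gen_comm_assoc (a := c) (b := a) (fun h => hac' h.symm),
        gen_comm_assoc (a := c) (b := a) (fun h => hac' h.symm), gen_comm_assoc hcb']
      exact .braid _ hab

end LcmRel

theorem _root_.FreeMonoid.of_mul_inj {α : Type*} {a b : α} {u v : FreeMonoid α}
    (h : FreeMonoid.of a * u = FreeMonoid.of b * v) : a = b ∧ u = v :=
  List.cons.inj h

/-- Garside's lemma for triangle-free graphs: a common right multiple of two generators is a right
multiple of their least common right multiple. -/
theorem lcmRel_of_gen_mul_eq (hΓ : ∀ a b c, Γ.Adj a c → Γ.Adj c b → ¬ Γ.Adj a b)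
    {a b : S} {u v : ArtinMonoid Γ} (h : gen Γ a * u = gen Γ b * v) : LcmRel Γ a b u v := by
  induction hk : length u using Nat.strong_induction_on generalizing a b u v with
  | _ k ih =>
  have ih' : ∀ (a b : S) (p q : ArtinMonoid Γ), length p < k →
      gen Γ a * p = gen Γ b * q → LcmRel Γ a b p q := fun a b p q hl h => ih _ hl h rfl
  clear ih
  let mk := PresentedMonoid.mk (ArtinRel Γ)
  have key : ∀ w w' : FreeMonoid S, conGen (ArtinRel Γ) w w' → mk w = mk w' ∧
      (w.length ≤ k + 1 → ∀ a b u v, w = .of a * u → w' = .of b * v →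
        LcmRel Γ a b (mk u) (mk v)) := by
    intro w w' hw
    induction hw with
    | of x y hxy =>
      refine ⟨PresentedMonoid.mk_eq_mk_of_rel hxy, fun hl a b u v hu hv => ?_⟩
      cases hxy with
      | @braid p q hpq =>
        obtain ⟨rfl, rfl⟩ := FreeMonoid.of_mul_inj ((mul_assoc _ _ _).symm.trans hu)
        obtain ⟨rfl, rfl⟩ := FreeMonoid.of_mul_inj ((mul_assoc _ _ _).symm.trans hv)
        have := LcmRel.braid 1 hpq
        rwa [mul_one, mul_one] at this
      | @comm p q hpq =>
        obtain ⟨rfl, rfl⟩ := FreeMonoid.of_mul_inj hu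
        obtain ⟨rfl, rfl⟩ := FreeMonoid.of_mul_inj hv
        rcases eq_or_ne p q with rfl | hne
        · exact .eq _ _
        have := LcmRel.comm 1 hne hpq
        rwa [mul_one, mul_one] at this
    | refl x =>
      refine ⟨rfl, fun hl a b u v hu hv => ?_⟩
      obtain ⟨rfl, rfl⟩ := FreeMonoid.of_mul_inj (hu.symm.trans hv)
      exact .eq _ _
    | symm h ih =>
      have hlen := congrArg length ih.1
      simp only [mk, length_mk] at hlen
      exact ⟨ih.1.symm, fun hl a b u v hu hv => (ih.2 (by omega) _ _ _ _ hv hu).symm⟩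
    | @trans x y z h h' ih ih₂ =>
      have hlen := congrArg length ih.1
      simp only [mk, length_mk] at hlen
      refine ⟨ih.1.trans ih₂.1, fun hl a b u v hu hv => ?_⟩
      induction y using FreeMonoid.casesOn with
      | one => simp [hu] at hlen
      | of_mul c y =>
        refine LcmRel.trans hΓ (fun a b p q hp => ih' a b p q (hp.trans_le ?_))
          (ih.2 hl _ _ _ _ hu rfl) (ih₂.2 (by omega) _ _ _ _ rfl hv)
        simp only [mk, length_mk, FreeMonoid.length_mul, FreeMonoid.length_of] at hlen ⊢
        omega
    | @mul w x y z h h' ih ih₂ =>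
      have hlen := congrArg length ih.1
      simp only [mk, length_mk] at hlen
      refine ⟨by rw [map_mul, map_mul, ih.1, ih₂.1], fun hl a b u v hu hv => ?_⟩
      rw [FreeMonoid.length_mul] at hl
      induction w using FreeMonoid.casesOn with
      | one =>
        obtain rfl := FreeMonoid.length_eq_zero.1 hlen.symm
        exact ih₂.2 (by omega) _ _ _ _ hu hv
      | of_mul c w =>
        induction x using FreeMonoid.casesOn with
        | one => simp at hlen
        | of_mul d x =>
          obtain ⟨rfl, rfl⟩ := FreeMonoid.of_mul_inj ((mul_assoc _ _ _).symm.trans hu)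
          obtain ⟨rfl, rfl⟩ := FreeMonoid.of_mul_inj ((mul_assoc _ _ _).symm.trans hv)
          rw [map_mul, map_mul, ← ih₂.1]
          exact (ih.2 (by omega) _ _ _ _ rfl rfl).mul_right _
  obtain ⟨u, rfl⟩ := PresentedMonoid.surjective_mk u
  obtain ⟨v, rfl⟩ := PresentedMonoid.surjective_mk v
  refine (key (.of a * u) (.of b * v) ?_).2 ?_ _ _ _ _ rfl rfl
  · exact PresentedMonoid.mk_eq_mk_iff.1 h
  · rw [length_mk] at hk
    simp; omega

theorem mul_left_cancel_of_triangleFree (hΓ : ∀ a b c, Γ.Adj a c → Γ.Adj c b → ¬ Γ.Adj a b)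
    {x u v : ArtinMonoid Γ} (h : x * u = x * v) : u = v := by
  induction hk : length x generalizing x with
  | zero =>
    obtain rfl | ⟨a, y, rfl⟩ := eq_one_or_exists_gen_mul x
    · simpa using h
    · simp at hk
  | succ k ih =>
    obtain rfl | ⟨a, y, rfl⟩ := eq_one_or_exists_gen_mul x
    · simp at hk
    · rw [mul_assoc, mul_assoc] at h
      exact ih (lcmRel_of_gen_mul_eq hΓ h).eq_of_self (by simp at hk; omega)

theorem gen_dvd_of_dvd_gen_mul (hΓ : ∀ a b c, Γ.Adj a c → Γ.Adj c b → ¬ Γ.Adj a b)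
    {a b : S} (hab : a ≠ b) {x : ArtinMonoid Γ} (h : gen Γ b ∣ gen Γ a * x) : gen Γ b ∣ x := by
  obtain ⟨y, hy⟩ := h
  cases lcmRel_of_gen_mul_eq hΓ hy with
  | eq => exact absurd rfl hab
  | comm w => exact ⟨_, rfl⟩
  | braid w => exact ⟨_, rfl⟩

theorem gen_dvd_of_dvd_gen_mul_gen_mul (hΓ : ∀ a b c, Γ.Adj a c → Γ.Adj c b → ¬ Γ.Adj a b)
    {a b : S} (hab : Γ.Adj a b) {x : ArtinMonoid Γ} (h : gen Γ b ∣ gen Γ a * (gen Γ b * x)) :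
    gen Γ a ∣ x := by
  obtain ⟨y, hy⟩ := h
  obtain ⟨w, hw, -⟩ := (lcmRel_of_gen_mul_eq hΓ hy).exists_of_adj hab
  exact ⟨w, (lcmRel_of_gen_mul_eq hΓ hw).eq_of_self⟩

theorem gen_dvd_of_dvd_gen_pow_mul (hΓ : ∀ a b c, Γ.Adj a c → Γ.Adj c b → ¬ Γ.Adj a b)
    {a b : S} (hab : a ≠ b) {x : ArtinMonoid Γ} {k : ℕ} (h : gen Γ b ∣ gen Γ a ^ k * x) :
    gen Γ b ∣ x := by
  induction k with
  | zero => simpa using h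
  | succ k ih =>
    rw [pow_succ', mul_assoc] at h
    exact ih (gen_dvd_of_dvd_gen_mul hΓ hab h)

theorem not_gen_dvd_one (a : S) : ¬ gen Γ a ∣ 1 := by
  rintro ⟨x, hx⟩
  have := congrArg length hx
  simp at this
  omega

/-- In a triangle-free Artin monoid, an element intertwining powers of two generators intertwines
the generators themselves. -/
theorem gen_mul_eq_mul_gen_of_pow (hΓ : ∀ a b c, Γ.Adj a c → Γ.Adj c b → ¬ Γ.Adj a b)
    {a b : S} {x : ArtinMonoid Γ} {N : ℕ} (hN : N ≠ 0)
    (h : gen Γ a ^ N * x = x * gen Γ b ^ N) : gen Γ a * x = x * gen Γ b := by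
  induction hk : length x using Nat.strong_induction_on generalizing a x with
  | _ k ih =>
  obtain rfl | ⟨s, y, rfl⟩ := eq_one_or_exists_gen_mul x
  · rcases eq_or_ne a b with rfl | hab
    · simp
    refine absurd (gen_dvd_of_dvd_gen_pow_mul (x := 1) (k := N) hΓ hab ?_) (not_gen_dvd_one b)
    rw [h, one_mul]
    exact dvd_pow_self _ hN
  simp only [length_mul, length_gen] at hk
  by_cases hadj : Γ.Adj a s
  · have hdvd : gen Γ s ∣ gen Γ a * (gen Γ s * y) := by
      obtain ⟨M, rfl⟩ := Nat.exists_eq_succ_of_ne_zero hN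
      rw [pow_succ, mul_assoc] at h
      exact gen_dvd_of_dvd_gen_pow_mul hΓ hadj.ne (Dvd.intro _ (by rw [h, mul_assoc]))
    obtain ⟨w, rfl⟩ := gen_dvd_of_dvd_gen_mul_gen_mul hΓ hadj hdvd
    have hpow : gen Γ a ^ N * (gen Γ s * gen Γ a) = gen Γ s * gen Γ a * gen Γ s ^ N := by
      have : SemiconjBy (gen Γ s * gen Γ a) (gen Γ s) (gen Γ a) := by
        simp only [SemiconjBy, ← mul_assoc, gen_braid hadj]
      exact (this.pow_right N).symm
    have hw : gen Γ s * w = w * gen Γ b := by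
      refine ih (length w) (by simp at hk; omega) ?_ rfl
      apply mul_left_cancel_of_triangleFree hΓ (x := gen Γ s * gen Γ a)
      rw [← mul_assoc, ← hpow]
      simpa only [mul_assoc] using h
    rw [gen_braid_assoc hadj, hw]
    simp only [mul_assoc]
  · have hcomm : Commute (gen Γ a) (gen Γ s) := gen_comm hadj
    have hy : gen Γ a * y = y * gen Γ b := by
      refine ih (length y) (by omega) ?_ rfl
      apply mul_left_cancel_of_triangleFree hΓ (x := gen Γ s)
      rw [← mul_assoc, ← (hcomm.pow_left N).eq, mul_assoc, h, mul_assoc]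
    rw [gen_comm_assoc hadj, hy, mul_assoc]

theorem gen_injective (hΓ : ∀ a b c, Γ.Adj a c → Γ.Adj c b → ¬ Γ.Adj a b) :
    Function.Injective (gen Γ) := by
  intro a b h
  by_contra hab
  refine not_gen_dvd_one b (gen_dvd_of_dvd_gen_mul hΓ hab (x := 1) ?_)
  rw [mul_one, h]

/-- An element is quasi-central if every generator can be moved through it from left to right,
possibly changing on the way. -/
def IsQuasiCentral (x : ArtinMonoid Γ) : Prop := ∀ a, ∃ y, gen Γ a * x = x * y

theorem IsQuasiCentral.gen_dvd (hΓ : ∀ a b c, Γ.Adj a c → Γ.Adj c b → ¬ Γ.Adj a b)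
    (hc : Γ.Preconnected) {x : ArtinMonoid Γ} (hx : IsQuasiCentral x) (hne : x ≠ 1) (a : S) :
    gen Γ a ∣ x := by
  obtain ⟨s, y, hy⟩ := (eq_one_or_exists_gen_mul x).resolve_left hne
  obtain ⟨p⟩ := hc s a
  have hs : gen Γ s ∣ x := ⟨y, hy⟩
  clear hy
  induction p with
  | nil => exact hs
  | @cons s t _ hst _ ih =>
    apply ih
    obtain ⟨y, rfl⟩ := hs
    obtain ⟨t', ht⟩ := hx t
    obtain ⟨s', hs⟩ := hx s
    rw [mul_assoc] at ht
    obtain ⟨w, hw, -⟩ := (lcmRel_of_gen_mul_eq hΓ ht).exists_of_adj hst.symm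
    rw [hw, mul_assoc] at hs
    exact ⟨w * s', by rw [hw, (lcmRel_of_gen_mul_eq hΓ hs).eq_of_self, mul_assoc]⟩

end ArtinMonoid

section BraidSequence

variable {M : Type*} [Monoid M]

/-- The first `n` terms of the sequence `s` satisfy the braid relations. -/
structure IsBraidSeq (n : ℕ) (s : ℕ → M) : Prop where
  comm : ∀ i j, i + 2 ≤ j → j < n → s i * s j = s j * s i
  braid : ∀ i, i + 1 < n → s i * s (i + 1) * s i = s (i + 1) * s i * s (i + 1)

/-- The product `s 0 * s 1 * ⋯ * s (k - 1)`. -/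
def ascProd (s : ℕ → M) : ℕ → M
  | 0 => 1
  | k + 1 => ascProd s k * s k

theorem ascProd_succ (s : ℕ → M) (k : ℕ) : ascProd s (k + 1) = ascProd s k * s k := rfl

/-- The product `s (k - 1) * ⋯ * s 1 * s 0`. -/
def descProd (s : ℕ → M) : ℕ → M
  | 0 => 1
  | k + 1 => s k * descProd s k

/-- Garside's element (the half twist) on the first `k` terms of the sequence `s`. -/
def halfTwist (s : ℕ → M) : ℕ → M
  | 0 => 1
  | k + 1 => ascProd s (k + 1) * halfTwist s k

theorem descProd_shift_succ (s : ℕ → M) (a j : ℕ) :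
    descProd (fun i => s (a + i)) (j + 1) = descProd (fun i => s (a + 1 + i)) j * s a := by
  induction j with
  | zero => simp [descProd]
  | succ j ih =>
    rw [descProd, ih, descProd, mul_assoc]
    congr 2
    omega

theorem dvd_ascProd_succ (s : ℕ → M) (k : ℕ) : s 0 ∣ ascProd s (k + 1) := by
  induction k with
  | zero => simp [ascProd]
  | succ k ih => exact ih.mul_right _

namespace IsBraidSeq

variable {n : ℕ} {s : ℕ → M}

theorem commute_ascProd (h : IsBraidSeq n s) {k j : ℕ} (hk : k < j) (hj : j < n) :
    Commute (s j) (ascProd s k) := by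
  induction k with
  | zero => exact Commute.one_right _
  | succ k ih => exact (ih (by omega)).mul_right (h.comm k j (by omega) hj).symm

theorem commute_descProd (h : IsBraidSeq n s) {k j : ℕ} (hk : k < j) (hj : j < n) :
    Commute (s j) (descProd s k) := by
  induction k with
  | zero => exact Commute.one_right _
  | succ k ih => exact Commute.mul_right (h.comm k j (by omega) hj).symm (ih (by omega))

theorem commute_halfTwist (h : IsBraidSeq n s) {k j : ℕ} (hk : k < j) (hj : j < n) :
    Commute (s j) (halfTwist s k) := by
  induction k with
  | zero => exact Commute.one_right _
  | succ k ih => exact (h.commute_ascProd hk hj).mul_right (ih (by omega))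

theorem semiconjBy_ascProd (h : IsBraidSeq n s) {i k : ℕ} (hi : i + 1 < k) (hk : k ≤ n) :
    SemiconjBy (ascProd s k) (s i) (s (i + 1)) := by
  induction k with
  | zero => omega
  | succ k ih =>
    rcases Nat.lt_or_ge (i + 1) k with hik | hik
    · exact (ih hik (by omega)).mul_left (h.comm i k (by omega) hk).symm
    · obtain rfl : k = i + 1 := by omega
      have := h.commute_ascProd (k := i) (j := i + 1) (by omega) (by omega)
      rw [SemiconjBy, ascProd, ascProd, mul_assoc, mul_assoc, ← mul_assoc (s i),
        h.braid i (by omega), ← mul_assoc, ← mul_assoc, ← this.eq]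
      simp only [mul_assoc]

theorem semiconjBy_descProd (h : IsBraidSeq n s) {i k : ℕ} (hi : i + 1 < k) (hk : k ≤ n) :
    SemiconjBy (descProd s k) (s (i + 1)) (s i) := by
  induction k with
  | zero => omega
  | succ k ih =>
    rcases Nat.lt_or_ge (i + 1) k with hik | hik
    · exact SemiconjBy.mul_left (h.comm i k (by omega) hk).symm (ih hik (by omega))
    · obtain rfl : k = i + 1 := by omega
      have := h.commute_descProd (k := i) (j := i + 1) (by omega) (by omega)
      rw [SemiconjBy, descProd, descProd, mul_assoc, mul_assoc, ← this.eq, ← mul_assoc,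
        ← mul_assoc, ← h.braid i (by omega)]
      simp only [mul_assoc]

theorem mul_ascProd_mul_ascProd (h : IsBraidSeq n s) {k m : ℕ} (hk : k < m) (hm : m ≤ n) :
    s 0 * (ascProd s m * ascProd s k) = ascProd s (k + 1) * ascProd s m := by
  induction k with
  | zero => simp [ascProd]
  | succ k ih =>
    rw [ascProd, ← mul_assoc (ascProd s m), ← mul_assoc (s 0), ih (by omega), mul_assoc,
      (h.semiconjBy_ascProd hk hm).eq, ← mul_assoc, ← ascProd_succ]

theorem semiconjBy_halfTwist (h : IsBraidSeq n s) {i j k : ℕ} (hijk : i + j + 1 = k)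
    (hk : k ≤ n) : SemiconjBy (halfTwist s k) (s i) (s j) := by
  induction k generalizing i j with
  | zero => omega
  | succ k ih =>
    rcases j with _ | j
    · obtain rfl : i = k := by omega
      rcases i with _ | i
      · simp [halfTwist, ascProd, SemiconjBy]
      · have := (h.commute_halfTwist (k := i) (j := i + 1) (by omega) (by omega)).eq
        rw [SemiconjBy, halfTwist, halfTwist, mul_assoc, mul_assoc, ← this,
          ← mul_assoc (ascProd s (i + 1)), ← ascProd_succ, ← mul_assoc,
          ← h.mul_ascProd_mul_ascProd (k := i + 1) (by omega) hk]
        simp only [mul_assoc]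
    · exact (h.semiconjBy_ascProd (by omega) hk).mul_left (ih (by omega) (by omega))

theorem semiconjBy_ascProd_descProd (h : IsBraidSeq n s) {a j m : ℕ} (ha : a + j < m)
    (hm : m ≤ n) : SemiconjBy (ascProd s m) (descProd (fun i => s (a + i)) j)
      (descProd (fun i => s (a + 1 + i)) j) := by
  induction j with
  | zero => exact SemiconjBy.one_right _
  | succ j ih =>
    refine SemiconjBy.mul_right ?_ (ih (by omega))
    beta_reduce
    rw [show a + 1 + j = a + j + 1 by omega]
    exact h.semiconjBy_ascProd (by omega) hm

theorem ascProd_succ_pow (h : IsBraidSeq n s) {a j k : ℕ} (hj : j + a = k + 1) (hk : k + 1 ≤ n) :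
    ascProd s (k + 1) ^ j = ascProd s k ^ j * descProd (fun i => s (a + i)) j := by
  induction j generalizing a with
  | zero => simp [descProd]
  | succ j ih =>
    rw [pow_succ, ih (a := a + 1) (by omega), mul_assoc,
      ← (h.semiconjBy_ascProd_descProd (a := a) (j := j) (by omega) hk).eq, descProd, pow_succ,
      ascProd, show a + j = k by omega]
    simp only [mul_assoc]

theorem semiconjBy_halfTwist_ascProd (h : IsBraidSeq n s) {a j k : ℕ} (hj : j + a = k)
    (hk : k ≤ n) :
    SemiconjBy (halfTwist s k) (ascProd s j) (descProd (fun i => s (a + i)) j) := by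
  induction j generalizing a with
  | zero => exact SemiconjBy.one_right _
  | succ j ih =>
    rw [descProd_shift_succ]
    exact (ih (a := a + 1) (by omega)).mul_right (h.semiconjBy_halfTwist (by omega) hk)

theorem halfTwist_mul_self (h : IsBraidSeq n s) {k : ℕ} (hk : k ≤ n) :
    halfTwist s k * halfTwist s k = ascProd s k ^ (k + 1) := by
  induction k with
  | zero => simp [halfTwist, ascProd]
  | succ k ih =>
    have h1 := h.semiconjBy_halfTwist_ascProd (a := 0) (j := k + 1) (k := k + 1) (by omega) hk
    have h2 := h.ascProd_succ_pow (a := 0) (j := k + 1) (k := k) (by omega) hk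
    simp only [zero_add] at h1 h2
    have h3 : ∀ j ≤ k, Commute (descProd s (k + 1) * ascProd s (k + 1)) (ascProd s j) := by
      intro j hj
      induction j with
      | zero => exact Commute.one_right _
      | succ j ih =>
        exact (ih (by omega)).mul_right (SemiconjBy.mul_left
          (h.semiconjBy_descProd (by omega) hk) (h.semiconjBy_ascProd (by omega) hk))
    rw [show halfTwist s (k + 1) * halfTwist s (k + 1) =
        halfTwist s (k + 1) * (ascProd s (k + 1) * halfTwist s k) from rfl, ← mul_assoc, h1.eq,
      halfTwist, mul_assoc, mul_assoc, ih (by omega), ← mul_assoc,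
      ((h3 k le_rfl).pow_right (k + 1)).eq, ← mul_assoc, ← h2, ← pow_succ]

theorem dvd_halfTwist (h : IsBraidSeq n s) {i k : ℕ} (hi : i < k) (hk : k ≤ n) :
    s i ∣ halfTwist s k := by
  induction k generalizing i with
  | zero => omega
  | succ k ih =>
    rcases i with _ | i
    · exact (dvd_ascProd_succ s k).mul_right _
    · obtain ⟨y, hy⟩ := ih (i := i) (by omega) (by omega)
      rw [halfTwist, hy, ← mul_assoc, (h.semiconjBy_ascProd hi hk).eq, mul_assoc]
      exact dvd_mul_right _ _

theorem commute_halfTwist_mul_self (h : IsBraidSeq n s) {i : ℕ} (hi : i < n) :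
    Commute (halfTwist s n * halfTwist s n) (s i) :=
  SemiconjBy.mul_left (h.semiconjBy_halfTwist (i := n - 1 - i) (j := i) (by omega) le_rfl)
    (h.semiconjBy_halfTwist (by omega) le_rfl)

end IsBraidSeq

theorem map_ascProd {N : Type*} [Monoid N] (f : M →* N) (s : ℕ → M) (k : ℕ) :
    f (ascProd s k) = ascProd (fun i => f (s i)) k := by
  induction k with
  | zero => simp [ascProd]
  | succ k ih => simp [ascProd, ih]

theorem prod_ofFn_eq_ascProd (s : ℕ → M) (k : ℕ) :
    (List.ofFn fun i : Fin k => s i).prod = ascProd s k := by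
  induction k with
  | zero => simp [ascProd]
  | succ k ih => rw [List.ofFn_succ', List.concat_eq_append, List.prod_append, ascProd, ← ih]; simp

end BraidSequence

namespace ArtinMonoid

open SimpleGraph

theorem pathGraph_not_adj {n : ℕ} (a b c : Fin n) (hac : (pathGraph n).Adj a c)
    (hcb : (pathGraph n).Adj c b) : ¬ (pathGraph n).Adj a b := by
  rw [pathGraph_adj] at *
  omega

/-- The generators of the monoid of positive braids, as an infinite sequence (padded by `1`). -/
def pathGen (n i : ℕ) : ArtinMonoid (pathGraph n) :=
  if h : i < n then gen _ ⟨i, h⟩ else 1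

theorem pathGen_of_lt {n i : ℕ} (h : i < n) : pathGen n i = gen _ ⟨i, h⟩ := dif_pos h

theorem pathGen_coe {n : ℕ} (i : Fin n) : pathGen n i = gen _ i := dif_pos i.2

variable {n : ℕ} {x : ArtinMonoid (pathGraph n)}

theorem isBraidSeq_pathGen (n : ℕ) : IsBraidSeq n (pathGen n) where
  comm i j hij hj := by
    lift i to Fin n using by omega
    lift j to Fin n using hj
    simp only [pathGen_coe]
    exact gen_comm (by rw [pathGraph_adj]; omega)
  braid i hi := by
    rw [pathGen_of_lt hi, pathGen_of_lt (Nat.lt_of_succ_lt hi)]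
    exact gen_braid (by simp [pathGraph_adj])

theorem pathGen_dvd_of_dvd_ascProd_mul {k j : ℕ} (hk : k ≤ j) (hj : j < n)
    (h : pathGen n j ∣ ascProd (pathGen n) k * x) : pathGen n j ∣ x := by
  induction k generalizing x with
  | zero => simpa [ascProd] using h
  | succ k ih =>
    rw [ascProd, mul_assoc] at h
    have h' := ih (by omega) h
    rw [pathGen_of_lt hj] at h' ⊢
    rw [pathGen_of_lt (show k < n by omega)] at h'
    exact gen_dvd_of_dvd_gen_mul pathGraph_not_adj (by simp; omega) h'

theorem ascProd_dvd {k : ℕ} (hk : k ≤ n) (h : ∀ i < k, pathGen n i ∣ x) :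
    ascProd (pathGen n) k ∣ x := by
  induction k with
  | zero => exact one_dvd x
  | succ k ih =>
    obtain ⟨y, rfl⟩ := ih (by omega) (fun i hi => h i (by omega))
    exact mul_dvd_mul_left _ (pathGen_dvd_of_dvd_ascProd_mul le_rfl hk (h k (by omega)))

theorem pathGen_dvd_of_succ_dvd_ascProd_mul {i k : ℕ} (hi : i + 1 < k) (hk : k ≤ n)
    (h : pathGen n (i + 1) ∣ ascProd (pathGen n) k * x) : pathGen n i ∣ x := by
  induction k generalizing x with
  | zero => omega
  | succ k ih =>
    rcases Nat.lt_or_ge (i + 1) k with hik | hik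
    · rw [ascProd, mul_assoc] at h
      have h' := ih hik (by omega) h
      rw [pathGen_of_lt (show i < n by omega)] at h' ⊢
      rw [pathGen_of_lt (show k < n by omega)] at h'
      exact gen_dvd_of_dvd_gen_mul pathGraph_not_adj (by simp; omega) h'
    · obtain rfl : k = i + 1 := by omega
      rw [ascProd, ascProd, mul_assoc, mul_assoc] at h
      have h' := pathGen_dvd_of_dvd_ascProd_mul (by omega) (by omega) h
      rw [pathGen_of_lt (show i < n by omega)] at h' ⊢
      rw [pathGen_of_lt (show i + 1 < n by omega)] at h'
      exact gen_dvd_of_dvd_gen_mul_gen_mul pathGraph_not_adj (by simp [pathGraph_adj]) h'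

theorem halfTwist_dvd {k : ℕ} (hk : k ≤ n) (h : ∀ i < k, pathGen n i ∣ x) :
    halfTwist (pathGen n) k ∣ x := by
  induction k generalizing x with
  | zero => exact one_dvd x
  | succ k ih =>
    obtain ⟨y, rfl⟩ := ascProd_dvd hk h
    exact mul_dvd_mul_left _ (ih (by omega) fun i hi =>
      pathGen_dvd_of_succ_dvd_ascProd_mul (by omega) hk (h (i + 1) (by omega)))

theorem semiconjBy_halfTwist_gen (i : Fin n) :
    SemiconjBy (halfTwist (pathGen n) n) (gen _ i) (gen _ i.rev) := by
  rw [← pathGen_coe, ← pathGen_coe]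
  exact (isBraidSeq_pathGen n).semiconjBy_halfTwist (by rw [Fin.val_rev]; omega) le_rfl

theorem IsQuasiCentral.exists_eq_pow (hn : 0 < n) (hx : IsQuasiCentral x) :
    ∃ m : ℕ, x = halfTwist (pathGen n) n ^ m := by
  induction hk : length x using Nat.strong_induction_on generalizing x with
  | _ k ih =>
  rcases eq_or_ne x 1 with rfl | hne
  · exact ⟨0, (pow_zero _).symm⟩
  have hdvd (i : Fin n) := hx.gen_dvd pathGraph_not_adj (pathGraph_preconnected n) hne i
  obtain ⟨y, rfl⟩ : halfTwist (pathGen n) n ∣ x :=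
    halfTwist_dvd le_rfl fun i hi => by simpa [pathGen, hi] using hdvd ⟨i, hi⟩
  obtain ⟨t, ht⟩ := (isBraidSeq_pathGen n).dvd_halfTwist hn le_rfl
  obtain ⟨m, rfl⟩ := ih (length y) (by
      rw [← hk, length_mul, ht, pathGen_of_lt hn, length_mul, length_gen]; omega)
    (fun i => by
      obtain ⟨z, hz⟩ := hx i.rev
      refine ⟨z, mul_left_cancel_of_triangleFree pathGraph_not_adj
        (x := halfTwist (pathGen n) n) ?_⟩
      rw [← mul_assoc, (semiconjBy_halfTwist_gen i).eq, mul_assoc, hz, mul_assoc]) rfl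
  exact ⟨m + 1, (pow_succ' _ _).symm⟩

theorem commute_of_commute_gen {S : Type*} {Γ : SimpleGraph S} {z : ArtinMonoid Γ}
    (hz : ∀ a, Commute z (gen Γ a)) (x : ArtinMonoid Γ) : Commute z x := by
  induction hk : length x generalizing x with
  | zero =>
    obtain rfl | ⟨a, y, rfl⟩ := eq_one_or_exists_gen_mul x
    · exact Commute.one_right z
    · simp at hk
  | succ k ih =>
    obtain rfl | ⟨a, y, rfl⟩ := eq_one_or_exists_gen_mul x
    · exact Commute.one_right z
    · exact (hz a).mul_right (ih y (by simp at hk; omega))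

theorem commute_ascProd_pow (x : ArtinMonoid (pathGraph n)) :
    Commute (ascProd (pathGen n) n ^ (n + 1)) x := by
  rw [← (isBraidSeq_pathGen n).halfTwist_mul_self le_rfl]
  refine commute_of_commute_gen (fun a => ?_) x
  rw [← pathGen_coe]
  exact (isBraidSeq_pathGen n).commute_halfTwist_mul_self a.2

/-- A central positive braid on at least three strands is a power of the full twist. -/
theorem exists_eq_pow_of_commute_gen (hn : 2 ≤ n)
    (hx : ∀ a, gen (pathGraph n) a * x = x * gen _ a) :
    ∃ m : ℕ, x = (ascProd (pathGen n) n ^ (n + 1)) ^ m := by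
  obtain ⟨m, rfl⟩ := IsQuasiCentral.exists_eq_pow (x := x) (by omega) fun a => ⟨_, hx a⟩
  have hsq := (isBraidSeq_pathGen n).halfTwist_mul_self le_rfl
  rcases Nat.even_or_odd' m with ⟨c, rfl | rfl⟩
  · exact ⟨c, by rw [pow_mul, sq, hsq]⟩
  · exfalso
    let a : Fin n := ⟨0, by omega⟩
    have hc : Commute ((halfTwist (pathGen n) n) ^ (2 * c)) (gen _ a) := by
      rw [pow_mul, sq, hsq]
      exact (commute_ascProd_pow _).pow_left c
    have h1 := SemiconjBy.mul_left hc (semiconjBy_halfTwist_gen a.rev |> fun h => by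
      rwa [Fin.rev_rev] at h)
    rw [← pow_succ, SemiconjBy, hx a] at h1
    have h2 := gen_injective pathGraph_not_adj
      (mul_left_cancel_of_triangleFree pathGraph_not_adj h1)
    simp [a, Fin.ext_iff] at h2
    omega

theorem exists_dvd_pow (x : ArtinMonoid (pathGraph n)) :
    ∃ k : ℕ, x ∣ (ascProd (pathGen n) n ^ (n + 1)) ^ k := by
  induction hk : length x generalizing x with
  | zero =>
    obtain rfl | ⟨a, y, rfl⟩ := eq_one_or_exists_gen_mul x
    · exact ⟨0, one_dvd _⟩
    · simp at hk
  | succ k ih =>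
    obtain rfl | ⟨a, y, rfl⟩ := eq_one_or_exists_gen_mul x
    · exact ⟨0, one_dvd _⟩
    · obtain ⟨k, t, ht⟩ := ih y (by simp at hk; omega)
      obtain ⟨u, hu⟩ : gen _ a ∣ ascProd (pathGen n) n ^ (n + 1) := by
        rw [← (isBraidSeq_pathGen n).halfTwist_mul_self le_rfl, ← pathGen_coe]
        exact ((isBraidSeq_pathGen n).dvd_halfTwist a.2 le_rfl).mul_right _
      refine ⟨k + 1, t * u, ?_⟩
      have h1 := ((commute_ascProd_pow (gen _ a)).pow_left k).eq
      rw [pow_succ]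
      nth_rewrite 2 [hu]
      rw [← mul_assoc, h1, ht]
      simp only [mul_assoc]

end ArtinMonoid

/-- A left cancellative monoid with a central element `z` such that every element left divides a
power of `z` embeds into a group. -/
theorem exists_injective_hom_group.{u} {M : Type u} [Monoid M]
    (hcancel : ∀ x u v : M, x * u = x * v → u = v) (z : M) (hz : ∀ x, Commute z x)
    (hdvd : ∀ x, ∃ k : ℕ, x ∣ z ^ k) :
    ∃ (K : Type u) (_ : Group K) (f : M →* K), Function.Injective f := by
  choose k t ht using hdvd
  have hzk (m : ℕ) (x : M) : z ^ m * x = x * z ^ m := ((hz x).pow_left m).eq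
  have ht' (x : M) : t x * x = z ^ k x := by
    apply hcancel x
    rw [← mul_assoc, ← ht, hzk]
  let _ : OreLocalization.OreSet (⊤ : Submonoid M) :=
    { ore_right_cancel := fun r₁ r₂ s h => ⟨⟨z ^ k s, trivial⟩, by
        change z ^ k s * r₁ = z ^ k s * r₂
        rw [hzk, hzk, ht, ← mul_assoc, h, mul_assoc]⟩
      oreNum := fun r s => r * t s
      oreDenom := fun _ s => ⟨z ^ k s, trivial⟩
      ore_eq := fun r s => by
        change z ^ k s * r = r * t s * s
        rw [mul_assoc, ht', hzk] }
  let f : M →* OreLocalization (⊤ : Submonoid M) M := OreLocalization.numeratorHom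
  refine ⟨(OreLocalization (⊤ : Submonoid M) M)ˣ, inferInstance,
    IsUnit.liftRight f fun x =>
      OreLocalization.numerator_isUnit (⟨x, trivial⟩ : (⊤ : Submonoid M)), ?_⟩
  intro x y hxy
  have hf : f x = f y := congrArg Units.val hxy
  rw [OreLocalization.numeratorHom_apply, OreLocalization.numeratorHom_apply,
    OreLocalization.oreDiv_eq_iff] at hf
  obtain ⟨u, v, h1, h2⟩ := hf
  simp only [smul_eq_mul, OneMemClass.coe_one, mul_one] at h1 h2
  change (u : M) * y = v * x at h1
  exact (hcancel v _ _ (by rw [← h2, h1, h2])).symm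

namespace BraidGroup

open ArtinMonoid SimpleGraph

variable {n : ℕ}

theorem braidGen_comm {i j : Fin n} (h : (i : ℕ) + 2 ≤ j) :
    braidGen i * braidGen j = braidGen j * braidGen i :=
  PresentedGroup.mk_eq_mk_of_mul_inv_mem (.inr ⟨i, j, h, rfl⟩)

theorem braidGen_braid {i j : Fin n} (h : (i : ℕ) + 1 = j) :
    braidGen i * braidGen j * braidGen i = braidGen j * braidGen i * braidGen j :=
  PresentedGroup.mk_eq_mk_of_mul_inv_mem (.inl ⟨i, j, h, rfl⟩)

/-- The homomorphism from the monoid of positive braids to the braid group. -/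
def ofPositive (n : ℕ) : ArtinMonoid (pathGraph n) →* BraidGroup n :=
  PresentedMonoid.lift braidGen (by
    rintro _ _ (h | h) <;> rw [pathGraph_adj] at h <;> simp only [map_mul, FreeMonoid.lift_eval_of]
    · rcases h with h | h
      · exact braidGen_braid h
      · exact (braidGen_braid h).symm
    · rename_i a b
      rcases lt_trichotomy (a : ℕ) b with hab | hab | hab
      · exact braidGen_comm (by omega)
      · rw [Fin.ext hab]
      · exact (braidGen_comm (by omega)).symm)

@[simp] theorem ofPositive_gen (i : Fin n) : ofPositive n (gen _ i) = braidGen i := rfl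

/-- The monoid of positive braids embeds into the braid group. -/
theorem ofPositive_injective (n : ℕ) : Function.Injective (ofPositive n) := by
  obtain ⟨K, _, f, hf⟩ := exists_injective_hom_group
    (fun x u v => mul_left_cancel_of_triangleFree pathGraph_not_adj) _
    (commute_ascProd_pow (n := n)) exists_dvd_pow
  have hrels : ∀ r ∈ braidRels n, FreeGroup.lift (fun i => f (gen _ i)) r = 1 := by
    rintro _ (⟨i, j, hij, rfl⟩ | ⟨i, j, hij, rfl⟩)
    · have : (pathGraph n).Adj i j := pathGraph_adj.2 (.inl hij)
      simp only [map_mul, map_inv, FreeGroup.lift_apply_of, mul_inv_eq_one]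
      rw [← map_mul, ← map_mul, gen_braid this, map_mul, map_mul]
    · have : ¬ (pathGraph n).Adj i j := by rw [pathGraph_adj]; omega
      simp only [map_mul, map_inv, FreeGroup.lift_apply_of, mul_inv_eq_one]
      rw [← map_mul, gen_comm this, map_mul]
  have hg : (PresentedGroup.toGroup hrels).comp (ofPositive n) = f := by
    apply PresentedMonoid.ext
    intro i
    exact PresentedGroup.toGroup.of hrels
  intro x y hxy
  apply hf
  rw [← hg, MonoidHom.comp_apply, hxy, MonoidHom.comp_apply]

theorem ofPositive_ascProd_pow (n : ℕ) :
    ofPositive n (ascProd (pathGen n) n ^ (n + 1)) = fullTwist n := by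
  rw [map_pow, map_ascProd, ← prod_ofFn_eq_ascProd, fullTwist]
  simp only [pathGen_coe, ofPositive_gen]

theorem mem_center_of_commute_braidGen {g : BraidGroup n} (h : ∀ i, Commute g (braidGen i)) :
    g ∈ Subgroup.center (BraidGroup n) := by
  have : (⊤ : Subgroup (BraidGroup n)) ≤ Subgroup.centralizer {g} := by
    rw [← PresentedGroup.closure_range_of, Subgroup.closure_le]
    rintro _ ⟨i, rfl⟩
    exact Subgroup.mem_centralizer_singleton_iff.2 (h i).symm
  exact Subgroup.mem_center_iff.2 fun x =>
    Subgroup.mem_centralizer_singleton_iff.1 (this (Subgroup.mem_top x))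

theorem fullTwist_mem_center (n : ℕ) : fullTwist n ∈ Subgroup.center (BraidGroup n) := by
  refine mem_center_of_commute_braidGen fun i => ?_
  rw [← ofPositive_ascProd_pow, ← ofPositive_gen]
  exact (commute_ascProd_pow _).map _

/-- Every braid becomes positive after multiplication by a power of the full twist. -/
theorem exists_fullTwist_pow_mul_eq (g : BraidGroup n) :
    ∃ (k : ℕ) (p : ArtinMonoid (pathGraph n)), fullTwist n ^ k * g = ofPositive n p := by
  have hz (k : ℕ) (x : BraidGroup n) : x * fullTwist n ^ k = fullTwist n ^ k * x :=
    Subgroup.mem_center_iff.1 (pow_mem (fullTwist_mem_center n) k) x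
  have hg : g ∈ Subgroup.closure (Set.range (PresentedGroup.of (rels := braidRels n))) := by
    rw [PresentedGroup.closure_range_of]; trivial
  induction hg using Subgroup.closure_induction with
  | mem x hx =>
    obtain ⟨i, rfl⟩ := hx
    exact ⟨0, gen _ i, by rw [pow_zero, one_mul]; rfl⟩
  | one => exact ⟨0, 1, by simp⟩
  | mul x y _ _ hx hy =>
    obtain ⟨k, p, hp⟩ := hx
    obtain ⟨l, q, hq⟩ := hy
    refine ⟨k + l, p * q, ?_⟩
    rw [map_mul, ← hp, ← hq, pow_add, mul_assoc, mul_assoc, ← mul_assoc x, hz l x, mul_assoc]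
  | inv x _ hx =>
    obtain ⟨k, p, hp⟩ := hx
    obtain ⟨m, t, ht⟩ := exists_dvd_pow p
    refine ⟨m, t * (ascProd (pathGen n) n ^ (n + 1)) ^ k, ?_⟩
    have ht' := congrArg (ofPositive n) ht
    rw [map_mul, map_pow, ofPositive_ascProd_pow, ← hp] at ht'
    rw [← hz, map_mul, map_pow, ofPositive_ascProd_pow, ht', hz, inv_mul_eq_iff_eq_mul, ← mul_assoc,
      hz, mul_assoc]

/-- A braid on at least three strands commuting with a power of each generator is a power of the
full twist. -/
theorem exists_eq_fullTwist_zpow (hn : 2 ≤ n) {g : BraidGroup n}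
    (hg : ∀ i : Fin n, ∃ N ≠ 0, Commute g (braidGen i ^ N)) :
    ∃ k : ℤ, g = fullTwist n ^ k := by
  obtain ⟨k, p, hp⟩ := exists_fullTwist_pow_mul_eq g
  have hpc (i : Fin n) : gen _ i * p = p * gen _ i := by
    obtain ⟨N, hN, hc⟩ := hg i
    apply gen_mul_eq_mul_gen_of_pow pathGraph_not_adj hN
    apply ofPositive_injective n
    have hz : Commute (fullTwist n ^ k) (braidGen i ^ N) :=
      (Subgroup.mem_center_iff.1 (pow_mem (fullTwist_mem_center n) k) _).symm
    rw [map_mul, map_mul, map_pow, ofPositive_gen, ← hp]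
    exact (hz.mul_left hc).symm
  obtain ⟨m, rfl⟩ := exists_eq_pow_of_commute_gen hn hpc
  rw [map_pow, ofPositive_ascProd_pow] at hp
  refine ⟨-k + m, ?_⟩
  rw [zpow_add, zpow_neg, zpow_natCast, zpow_natCast, ← hp, inv_mul_cancel_left]

theorem not_isOfFinOrder_fullTwist (hn : 0 < n) : ¬ IsOfFinOrder (fullTwist n) := by
  rw [isOfFinOrder_iff_pow_eq_one]
  rintro ⟨m, hm, h⟩
  rw [← ofPositive_ascProd_pow, ← map_pow, ← map_one (ofPositive n)] at h
  have h' := ofPositive_injective n h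
  refine not_gen_dvd_one (Γ := pathGraph n) ⟨0, hn⟩ ?_
  rw [← h', ← pow_mul, ← pathGen_of_lt]
  obtain ⟨k, rfl⟩ := Nat.exists_eq_succ_of_ne_zero hn.ne'
  exact (dvd_ascProd_succ _ k).pow (by positivity)

end BraidGroup

/-- For `n ≥ 3`, if `G` is a finite-index subgroup of the braid group
`B_{n+1}`, then the center of `G` equals `G ∩ Z(B_{n+1})`; in particular `Z(G)` is infinite
cyclic and every central element of `G` is a power of the full twist `z`. -/
theorem center_finite_index_subgroup_braid
    (n : ℕ) (hn : 3 ≤ n) (G : Subgroup (BraidGroup n)) (hG : G.FiniteIndex) :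
    (∀ g : G, g ∈ Subgroup.center G ↔ (g : BraidGroup n) ∈ Subgroup.center (BraidGroup n)) ∧
    (∃ ζ : G, Subgroup.center G = Subgroup.zpowers ζ ∧ ¬ IsOfFinOrder ζ) ∧
    (∀ g : G, g ∈ Subgroup.center G → ∃ k : ℤ, (g : BraidGroup n) = fullTwist n ^ k) := by
  have hpow (g : G) (hg : g ∈ Subgroup.center G) :
      ∃ k : ℤ, (g : BraidGroup n) = fullTwist n ^ k := by
    refine BraidGroup.exists_eq_fullTwist_zpow (by omega) fun i => ?_
    obtain ⟨N, hN, -, hmem⟩ :=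
      Subgroup.exists_pow_mem_of_index_ne_zero hG.index_ne_zero (braidGen i)
    exact ⟨N, hN.ne', (congrArg Subtype.val (Subgroup.mem_center_iff.1 hg ⟨_, hmem⟩)).symm⟩
  have hiff (g : G) : g ∈ Subgroup.center G ↔
      (g : BraidGroup n) ∈ Subgroup.center (BraidGroup n) := by
    refine ⟨fun hg => ?_, fun hg => Subgroup.mem_center_iff.2 fun x =>
      Subtype.ext (Subgroup.mem_center_iff.1 hg x)⟩
    obtain ⟨k, hk⟩ := hpow g hg
    rw [hk]
    exact zpow_mem (BraidGroup.fullTwist_mem_center n) k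
  refine ⟨hiff, ?_, hpow⟩
  have hinf := BraidGroup.not_isOfFinOrder_fullTwist (n := n) (by omega)
  have hle : (Subgroup.center G).map G.subtype ≤ Subgroup.zpowers (fullTwist n) := by
    rintro _ ⟨g, hg, rfl⟩
    obtain ⟨k, hk⟩ := hpow g hg
    exact ⟨k, hk.symm⟩
  obtain ⟨k, hk⟩ := (Subgroup.le_zpowers_iff _ _).1 hle
  obtain ⟨ζ, hζ, hζk⟩ : fullTwist n ^ k ∈ (Subgroup.center G).map G.subtype := by
    rw [hk]; exact Subgroup.mem_zpowers _
  have hcenter : Subgroup.center G = Subgroup.zpowers ζ := by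
    apply Subgroup.map_injective G.subtype_injective
    rw [hk, MonoidHom.map_zpowers, hζk]
  refine ⟨ζ, hcenter, fun hfin => hinf ?_⟩
  obtain ⟨N, hN, -, hmem⟩ := Subgroup.exists_pow_mem_of_index_ne_zero hG.index_ne_zero (fullTwist n)
  have hz : (⟨_, hmem⟩ : G) ∈ Subgroup.zpowers ζ := by
    rw [← hcenter, hiff]
    exact pow_mem (BraidGroup.fullTwist_mem_center n) N
  obtain ⟨m, hm⟩ := hz
  have : IsOfFinOrder (fullTwist n ^ N) := by
    exact G.subtype.isOfFinOrder (show IsOfFinOrder (⟨_, hmem⟩ : G) from hm ▸ hfin.zpow)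
  exact this.of_pow hN.ne'
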